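/- Let α, β, γ be integers and let n, k, ℓ be nonnegative integers with k ≥ 1. Then S^{γ,α,β}_{n+1,k,ℓ} = γ · S^{γ,α,β}_{n,k,ℓ} + Σ_{i=0}^{n} C(n,i) · S^{γ,α,β}_{i,k−1,ℓ} · S^{0,α,β}_{n−i+1,1,ℓ}, where C(n,i) is the binomial coefficient. -/

import Mathlib

open Finset
open scoped Classical

/-- Degenerate falling factorial `(t)_{m,λ} = t(t-λ)⋯(t-(m-1)λ)`. -/
def dff {R : Type*} [CommRing R] (t : R) (m : ℕ) (lam : R) : R :=
  ∏ i ∈ Finset.range m, (t - (i : R) * lam)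

/-- `P` is a set partition of the finset `S` into `k` nonempty blocks. -/
def IsPartitionInto {n : ℕ} (S : Finset (Fin n)) (k : ℕ)
    (P : Finset (Finset (Fin n))) : Prop :=
  P.card = k ∧ (∀ B ∈ P, B.Nonempty) ∧
    (∀ B ∈ P, ∀ C ∈ P, B ≠ C → Disjoint B C) ∧ P.sup id = S

/-- Generalized Stirling number `S_{α,β,γ}(n,k)`: weighted sum over pairs `(G,P)`
where `G ⊆ [n]` and `P` partitions `[n] \ G` into `k` nonempty blocks, with weight
`(γ)_{|G|,α} · ∏_{B∈P} (β-α)_{|B|-1,α}`. -/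
noncomputable def genStirling {R : Type*} [CommRing R] (a b g : R) (n k : ℕ) : R :=
  ∑ G : Finset (Fin n),
    ∑ P ∈ Finset.univ.filter (fun P => IsPartitionInto Gᶜ k P),
      dff g G.card a * ∏ B ∈ P, dff (b - a) (B.card - 1) a

/-- Restricted generalized Stirling number `S^{≤ℓ}_{α,β,γ}(n,k)`:
as `genStirling` but every block of `P` has at most `ℓ` elements. -/
noncomputable def genStirlingLe {R : Type*} [CommRing R] (a b g : R) (n k l : ℕ) : R :=
  ∑ G : Finset (Fin n),
    ∑ P ∈ Finset.univ.filter
        (fun P => IsPartitionInto Gᶜ k P ∧ ∀ B ∈ P, B.card ≤ l),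
      dff g G.card a * ∏ B ∈ P, dff (b - a) (B.card - 1) a

/-- `S^{>ℓ}_γ(n,k)`: weighted sum over pairs `(G,P)` where `P` partitions
`[n] \ G` into `k` nonempty blocks each of size `> ℓ`, with weight `γ^{|G|}`. -/
noncomputable def Sgt {R : Type*} [CommRing R] (g : R) (n k l : ℕ) : R :=
  ∑ G : Finset (Fin n),
    ∑ _P ∈ Finset.univ.filter
        (fun P : Finset (Finset (Fin n)) =>
          IsPartitionInto Gᶜ k P ∧ ∀ B ∈ P, l < B.card),
      g ^ G.card

/-- Associated Stirling number of the second kind `S_{≥ℓ}(n,k)`: the number of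
set partitions of `[n]` into `k` nonempty blocks each of size at least `ℓ`. -/
noncomputable def assocStirling (n k l : ℕ) : ℕ :=
  (Finset.univ.filter
    (fun P : Finset (Finset (Fin n)) =>
      IsPartitionInto Finset.univ k P ∧ ∀ B ∈ P, l ≤ B.card)).card

/-- Partial degenerate partition number `S^{γ,α,β}_{n,k,ℓ}`: weighted sum over
pairs `(G,P)` with weight `γ^{|G|} · ∏_{B∈P, |B|≤ℓ} (β-α)_{|B|-1,α}`. -/
noncomputable def partialS {R : Type*} [CommRing R] (g a b : R) (n k l : ℕ) : R :=
  ∑ G : Finset (Fin n),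
    ∑ P ∈ Finset.univ.filter (fun P => IsPartitionInto Gᶜ k P),
      g ^ G.card * ∏ B ∈ P, (if B.card ≤ l then dff (b - a) (B.card - 1) a else 1)

/-- `S^{≤ℓ}_{α,β}(n,k)`: sum over set partitions of `[n]` into `k` nonempty blocks
each with at most `ℓ` elements, of the weight `∏_{B∈P} (β-α)_{|B|-1,α}`. -/
noncomputable def SleRestr {R : Type*} [CommRing R] (a b : R) (n k l : ℕ) : R :=
  ∑ P ∈ Finset.univ.filter
      (fun P : Finset (Finset (Fin n)) =>
        IsPartitionInto Finset.univ k P ∧ ∀ B ∈ P, B.card ≤ l),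
    ∏ B ∈ P, dff (b - a) (B.card - 1) a

/-- Weighted sum over the set partitions of `U` into `k` blocks, a block `B` having weight
`f |B|`. -/
noncomputable def blockSum {R : Type*} [CommRing R] (f : ℕ → R) {n : ℕ} (U : Finset (Fin n))
    (k : ℕ) : R :=
  ∑ P ∈ Finset.univ.filter (fun P => IsPartitionInto U k P), ∏ B ∈ P, f B.card

theorem blockSum_zero {R : Type*} [CommRing R] (f : ℕ → R) {n : ℕ} (U : Finset (Fin n)) :
    blockSum f U 0 = if U.card = 0 then 1 else 0 := by
  have h : Finset.univ.filter (fun P => IsPartitionInto U 0 P) =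
      if U.card = 0 then {∅} else ∅ := by
    ext P
    by_cases hU : U = ∅
    · subst hU
      simp only [mem_filter, mem_univ, true_and, card_empty, if_true, mem_singleton,
        IsPartitionInto, card_eq_zero]
      exact ⟨fun h => h.1, fun h => by subst h; simp⟩
    · simp only [mem_filter, mem_univ, true_and, card_eq_zero, hU, if_false, notMem_empty,
        iff_false, IsPartitionInto]
      rintro ⟨rfl, -, -, h⟩
      exact hU (by simpa using h.symm)
  unfold blockSum
  rw [h]
  split_ifs <;> simp

theorem blockSum_empty_succ {R : Type*} [CommRing R] (f : ℕ → R) {n : ℕ} (k : ℕ) :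
    blockSum f (∅ : Finset (Fin n)) (k + 1) = 0 := by
  unfold blockSum
  rw [Finset.filter_eq_empty_iff.2, sum_empty]
  rintro P - ⟨hc, hne, -, hs⟩
  obtain ⟨B, hB⟩ := card_pos.1 (by omega : 0 < P.card)
  have h1 : B ≤ P.sup id := Finset.le_sup (f := id) hB
  rw [hs] at h1
  exact (hne B hB).ne_empty (subset_empty.1 h1)

theorem IsPartitionInto.subset {n k : ℕ} {U : Finset (Fin n)} {P : Finset (Finset (Fin n))}
    (h : IsPartitionInto U k P) {B : Finset (Fin n)} (hB : B ∈ P) : B ⊆ U :=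
  h.2.2.2 ▸ Finset.le_sup (f := id) hB

/-- Adjoining to a partition of `T ⊆ U` the block formed by `x` and `U \ T`. -/
theorem IsPartitionInto.insert_block {n k : ℕ} {U T : Finset (Fin n)} {x : Fin n}
    (hx : x ∉ U) (hT : T ⊆ U) {P : Finset (Finset (Fin n))} (h : IsPartitionInto T k P) :
    insert x (U \ T) ∉ P ∧
      IsPartitionInto (insert x U) (k + 1) (insert (insert x (U \ T)) P) := by
  have hd : ∀ B ∈ P, Disjoint (insert x (U \ T)) B := by
    intro B hB
    have hBT := h.subset hB
    rw [Finset.disjoint_left]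
    intro y hy hyB
    rcases mem_insert.1 hy with rfl | hy
    · exact hx (hT (hBT hyB))
    · exact (mem_sdiff.1 hy).2 (hBT hyB)
  have hnot : insert x (U \ T) ∉ P := fun hB =>
    hx (hT (h.subset hB (mem_insert_self _ _)))
  refine ⟨hnot, ?_, ?_, ?_, ?_⟩
  · rw [card_insert_of_notMem hnot, h.1]
  · intro B hB
    rcases mem_insert.1 hB with rfl | hB
    · exact insert_nonempty _ _
    · exact h.2.1 B hB
  · intro B hB C hC hne
    rcases mem_insert.1 hB with rfl | hB <;> rcases mem_insert.1 hC with rfl | hC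
    · exact absurd rfl hne
    · exact hd C hC
    · exact (hd B hB).symm
    · exact h.2.2.1 B hB C hC hne
  · rw [sup_insert, h.2.2.2, id, sup_eq_union, insert_union, sdiff_union_of_subset hT]

/-- Deleting the block of `x` from a partition of `insert x U`. -/
theorem IsPartitionInto.exists_block {n k : ℕ} {U : Finset (Fin n)} {x : Fin n}
    (hx : x ∉ U) {P : Finset (Finset (Fin n))} (h : IsPartitionInto (insert x U) (k + 1) P) :
    (P.filter (x ∉ ·)).sup id ⊆ U ∧
      IsPartitionInto ((P.filter (x ∉ ·)).sup id) k (P.filter (x ∉ ·)) ∧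
      insert (insert x (U \ (P.filter (x ∉ ·)).sup id)) (P.filter (x ∉ ·)) = P := by
  have hmem : ∀ y, y ∈ insert x U ↔ ∃ B ∈ P, y ∈ B := by
    intro y
    rw [← h.2.2.2, mem_sup]; rfl
  have hmem' : ∀ y, y ∈ (P.filter (x ∉ ·)).sup id ↔ ∃ B ∈ P, x ∉ B ∧ y ∈ B := by
    intro y
    simp [mem_sup, and_assoc]
  obtain ⟨B, hB, hxB⟩ := (hmem x).1 (mem_insert_self _ _)
  have huniq : ∀ C ∈ P, ∀ y ∈ B, y ∈ C → C = B := by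
    intro C hC y hy hyC
    by_contra hne
    exact Finset.disjoint_left.1 (h.2.2.1 C hC B hB hne) hyC hy
  have hfil : P.filter (x ∉ ·) = P.erase B := by
    ext C
    simp only [mem_filter, mem_erase]
    constructor
    · rintro ⟨hC, hxC⟩
      exact ⟨fun e => hxC (e ▸ hxB), hC⟩
    · rintro ⟨hne, hC⟩
      exact ⟨hC, fun hxC => hne (huniq C hC x hxB hxC)⟩
  have hblock : insert x (U \ (P.filter (x ∉ ·)).sup id) = B := by
    ext y
    rw [mem_insert, mem_sdiff, hmem']
    constructor
    · rintro (rfl | ⟨hy, hn⟩)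
      · exact hxB
      · obtain ⟨C, hC, hyC⟩ := (hmem y).1 (mem_insert_of_mem hy)
        by_cases hxC : x ∈ C
        · exact huniq C hC x hxB hxC ▸ hyC
        · exact absurd ⟨C, hC, hxC, hyC⟩ hn
    · intro hy
      rcases mem_insert.1 ((hmem y).2 ⟨B, hB, hy⟩) with rfl | hyU
      · exact Or.inl rfl
      · refine Or.inr ⟨hyU, ?_⟩
        rintro ⟨C, hC, hxC, hyC⟩
        exact hxC (huniq C hC y hy hyC ▸ hxB)
  refine ⟨?_, ⟨?_, ?_, ?_, rfl⟩, ?_⟩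
  · intro y hy
    obtain ⟨C, hC, hxC, hyC⟩ := (hmem' y).1 hy
    rcases mem_insert.1 ((hmem y).2 ⟨C, hC, hyC⟩) with rfl | hyU
    · exact absurd hyC hxC
    · exact hyU
  · rw [hfil, card_erase_of_mem hB, h.1, Nat.add_sub_cancel]
  · exact fun C hC => h.2.1 C (mem_filter.1 hC).1
  · exact fun C hC D hD => h.2.2.1 C (mem_filter.1 hC).1 D (mem_filter.1 hD).1
  · rw [hblock, hfil, insert_erase hB]

theorem blockSum_insert_succ {R : Type*} [CommRing R] (f : ℕ → R) {n : ℕ} {U : Finset (Fin n)}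
    {x : Fin n} (hx : x ∉ U) (k : ℕ) :
    blockSum f (insert x U) (k + 1) =
      ∑ T ∈ U.powerset, blockSum f T k * f ((U \ T).card + 1) := by
  unfold blockSum
  simp_rw [Finset.sum_mul]
  rw [Finset.sum_sigma']
  symm
  refine Finset.sum_bij' (fun p _ => insert (insert x (U \ p.1)) p.2)
    (fun P _ => ⟨(P.filter (x ∉ ·)).sup id, P.filter (x ∉ ·)⟩) ?_ ?_ ?_ ?_ ?_
  · rintro ⟨T, P⟩ hp
    simp only [mem_sigma, mem_powerset, mem_filter, mem_univ, true_and] at hp ⊢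
    exact (hp.2.insert_block hx hp.1).2
  · intro P hP
    simp only [mem_sigma, mem_powerset, mem_filter, mem_univ, true_and] at hP ⊢
    exact ⟨(hP.exists_block hx).1, (hP.exists_block hx).2.1⟩
  · rintro ⟨T, P⟩ hp
    simp only [mem_sigma, mem_powerset, mem_filter, mem_univ, true_and] at hp
    have hfil : (insert (insert x (U \ T)) P).filter (x ∉ ·) = P := by
      rw [filter_insert, if_neg (by simp), filter_true_of_mem]
      exact fun B hB hxB => hx (hp.1 (hp.2.subset hB hxB))
    dsimp only
    rw [hfil, hp.2.2.2.2]
  · intro P hP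
    simp only [mem_filter, mem_univ, true_and] at hP
    exact (hP.exists_block hx).2.2
  · rintro ⟨T, P⟩ hp
    simp only [mem_sigma, mem_powerset, mem_filter, mem_univ, true_and] at hp
    dsimp only
    rw [prod_insert (hp.2.insert_block hx hp.1).1,
      card_insert_of_notMem (fun h => hx (mem_sdiff.1 h).1), mul_comm]

/-- The value of `blockSum` on a set with a given number of elements. -/
noncomputable def blockSumCard {R : Type*} [CommRing R] (f : ℕ → R) : ℕ → ℕ → R
  | 0, m => if m = 0 then 1 else 0
  | _ + 1, 0 => 0
  | k + 1, m + 1 =>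
      ∑ T ∈ (Finset.range m).powerset, blockSumCard f k T.card * f (m - T.card + 1)

theorem sum_powerset_congr_card {α β M : Type*} [AddCommMonoid M] (s : Finset α) (t : Finset β)
    (h : s.card = t.card) (F : ℕ → M) :
    ∑ T ∈ s.powerset, F T.card = ∑ T ∈ t.powerset, F T.card := by
  rw [sum_powerset_apply_card, sum_powerset_apply_card, h]

theorem blockSumCard_succ_succ {R : Type*} [CommRing R] (f : ℕ → R) {α : Type*} [DecidableEq α] (k : ℕ)
    (U : Finset α) :
    blockSumCard f (k + 1) (U.card + 1) =
      ∑ T ∈ U.powerset, blockSumCard f k T.card * f ((U \ T).card + 1) := by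
  rw [blockSumCard, sum_powerset_congr_card (range U.card) U (card_range _)
    (fun m => blockSumCard f k m * f (U.card - m + 1))]
  refine sum_congr rfl fun T hT => ?_
  rw [card_sdiff_of_subset (mem_powerset.1 hT)]

theorem blockSum_eq_blockSumCard {R : Type*} [CommRing R] (f : ℕ → R) {n : ℕ} (k : ℕ)
    (U : Finset (Fin n)) : blockSum f U k = blockSumCard f k U.card := by
  induction k generalizing U with
  | zero => rw [blockSum_zero, blockSumCard]
  | succ k ih =>
    rcases U.eq_empty_or_nonempty with rfl | ⟨x, hx⟩
    · rw [blockSum_empty_succ, card_empty, blockSumCard]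
    · rw [← insert_erase hx, blockSum_insert_succ f (notMem_erase x U),
        card_insert_of_notMem (notMem_erase x U), blockSumCard_succ_succ]
      exact sum_congr rfl fun T _ => by rw [ih]

/-- The weight of a block in `partialS`. -/
noncomputable def blockWeight {R : Type*} [CommRing R] (a b : R) (l m : ℕ) : R :=
  if m ≤ l then dff (b - a) (m - 1) a else 1

theorem partialS_eq_sum_powerset {R : Type*} [CommRing R] (g a b : R) (k l : ℕ) {α : Type*} [DecidableEq α]
    (S : Finset α) :
    partialS g a b S.card k l = ∑ G ∈ S.powerset,
      g ^ G.card * blockSumCard (blockWeight a b l) k (S \ G).card := by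
  have h1 : ∀ G ∈ S.powerset,
      g ^ G.card * blockSumCard (blockWeight a b l) k (S \ G).card =
        g ^ G.card * blockSumCard (blockWeight a b l) k (S.card - G.card) := fun G hG => by
    rw [card_sdiff_of_subset (mem_powerset.1 hG)]
  rw [sum_congr rfl h1, sum_powerset_congr_card S (univ : Finset (Fin S.card)) (by simp)
    (fun m => g ^ m * blockSumCard (blockWeight a b l) k (S.card - m)), powerset_univ]
  unfold partialS
  refine sum_congr rfl fun G _ => ?_
  rw [← mul_sum]
  have h2 := blockSum_eq_blockSumCard (blockWeight a b l) k Gᶜ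
  rw [card_compl, Fintype.card_fin] at h2
  rw [← h2]
  rfl

theorem partialS_zero_one {R : Type*} [CommRing R] (a b : R) (m l : ℕ) :
    partialS 0 a b (m + 1) 1 l = blockWeight a b l (m + 1) := by
  have h := partialS_eq_sum_powerset 0 a b 1 l (range (m + 1))
  rw [card_range] at h
  rw [h, sum_eq_single_of_mem ∅ (empty_mem_powerset _), card_empty, pow_zero, one_mul,
    sdiff_empty, card_range, blockSumCard, sum_eq_single_of_mem ∅ (empty_mem_powerset _)]
  · simp [blockSumCard]
  · intro T _ hT
    simp [blockSumCard, hT]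
  · intro G _ hG
    rw [zero_pow (card_ne_zero.2 (nonempty_iff_ne_empty.2 hG)), zero_mul]

theorem partialS_card_succ_succ {R : Type*} [CommRing R] (g a b : R) (k l : ℕ) {α : Type*} [DecidableEq α]
    {S : Finset α} {x : α} (hx : x ∉ S) :
    partialS g a b (S.card + 1) (k + 1) l = g * partialS g a b S.card (k + 1) l +
      ∑ T ∈ S.powerset, partialS g a b T.card k l * blockWeight a b l ((S \ T).card + 1) := by
  rw [← card_insert_of_notMem hx, partialS_eq_sum_powerset, sum_powerset_insert hx, add_comm]
  congr 1
  · rw [partialS_eq_sum_powerset, mul_sum]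
    refine sum_congr rfl fun G hG => ?_
    have hG' := mem_powerset.1 hG
    rw [card_insert_of_notMem (fun h => hx (hG' h)), insert_sdiff_insert,
      sdiff_insert_of_notMem hx, pow_succ']
    ring
  · simp_rw [partialS_eq_sum_powerset, sum_mul]
    have h1 : ∀ G ∈ S.powerset,
        g ^ G.card * blockSumCard (blockWeight a b l) (k + 1) (insert x S \ G).card =
          ∑ T ∈ (S \ G).powerset, g ^ G.card * (blockSumCard (blockWeight a b l) k T.card *
            blockWeight a b l (((S \ G) \ T).card + 1)) := fun G hG => by
      rw [insert_sdiff_of_notMem _ (fun h => hx (mem_powerset.1 hG h)),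
        card_insert_of_notMem (fun h => hx (mem_sdiff.1 h).1), blockSumCard_succ_succ, mul_sum]
    rw [sum_congr rfl h1, sum_sigma', sum_sigma']
    refine sum_bij' (fun p _ => ⟨p.1 ∪ p.2, p.1⟩) (fun p _ => ⟨p.2, p.1 \ p.2⟩) ?_ ?_ ?_ ?_ ?_
    · rintro ⟨G, T⟩ h
      simp only [mem_sigma, mem_powerset] at h ⊢
      exact ⟨union_subset h.1 (h.2.trans sdiff_subset), subset_union_left⟩
    · rintro ⟨T, G⟩ h
      simp only [mem_sigma, mem_powerset] at h ⊢
      exact ⟨h.2.trans h.1, sdiff_subset_sdiff h.1 subset_rfl⟩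
    · rintro ⟨G, T⟩ h
      simp only [mem_sigma, mem_powerset] at h
      dsimp only
      rw [union_sdiff_cancel_left (disjoint_sdiff.mono_right h.2)]
    · rintro ⟨T, G⟩ h
      simp only [mem_sigma, mem_powerset] at h
      dsimp only
      rw [union_sdiff_of_subset h.2]
    · rintro ⟨G, T⟩ h
      simp only [mem_sigma, mem_powerset] at h
      dsimp only
      rw [union_sdiff_cancel_left (disjoint_sdiff.mono_right h.2), sdiff_sdiff_left, sup_eq_union,
        mul_assoc]

theorem stmt11 (a b g : ℤ) (n k l : ℕ) (hk : 1 ≤ k) :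
    partialS g a b (n + 1) k l =
      g * partialS g a b n k l +
        ∑ i ∈ Finset.range (n + 1),
          (n.choose i : ℤ) * partialS g a b i (k - 1) l *
            partialS (0 : ℤ) a b (n - i + 1) 1 l := by
  obtain ⟨k, rfl⟩ := Nat.exists_eq_add_of_le' hk
  have h := partialS_card_succ_succ g a b k l (notMem_range_self (n := n))
  have h1 : ∀ T ∈ (range n).powerset,
      partialS g a b T.card k l * blockWeight a b l ((range n \ T).card + 1) =
        partialS g a b T.card k l * partialS 0 a b (n - T.card + 1) 1 l := fun T hT => by
    rw [card_sdiff_of_subset (mem_powerset.1 hT), card_range, partialS_zero_one]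
  rw [sum_congr rfl h1, sum_powerset_apply_card
    (fun m => partialS g a b m k l * partialS 0 a b (n - m + 1) 1 l), card_range] at h
  rw [h, Nat.add_sub_cancel]
  simp only [nsmul_eq_mul, mul_assoc]
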